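/- Let A and B be finite sets of integers with |A| ≥ 5, |B| ≥ 2, B ⊆ A, and |A +̂ B| = |A| + |B| - 3. Then the maximal element of A equals the maximal element of B, and the pair (X, Y) with X = A \ {max A} and Y = B \ {max B} also satisfies |X +̂ Y| = |X| + |Y| - 3. -/

import Mathlib

/-- The restricted sumset of two finite sets of integers:
`A +̂ B = {a + b : a ∈ A, b ∈ B, a ≠ b}`. -/
def restrictedSumset (A B : Finset ℤ) : Finset ℤ :=
  ((A ×ˢ B).filter fun p => p.1 ≠ p.2).image fun p => p.1 + p.2

lemma mem_rs {A B : Finset ℤ} {x : ℤ} :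
    x ∈ restrictedSumset A B ↔ ∃ p ∈ A, ∃ q ∈ B, p ≠ q ∧ p + q = x := by
  simp only [restrictedSumset, Finset.mem_image, Finset.mem_filter, Finset.mem_product, Prod.exists]
  constructor
  · rintro ⟨p, q, ⟨⟨h1, h2⟩, h3⟩, h4⟩
    exact ⟨p, h1, q, h2, h3, h4⟩
  · rintro ⟨p, h1, q, h2, h3, h4⟩
    exact ⟨p, q, ⟨⟨h1, h2⟩, h3⟩, h4⟩

lemma rs_mono {A B X Y : Finset ℤ} (h : X ⊆ A) (h' : Y ⊆ B) :
    restrictedSumset X Y ⊆ restrictedSumset A B := by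
  intro x hx
  rw [mem_rs] at hx ⊢
  obtain ⟨p, hp, q, hq, h3⟩ := hx
  exact ⟨p, h hp, q, h' hq, h3⟩

lemma two_new {C D : Finset ℤ} {u v : ℤ} (h : C ⊆ D) (hu : u ∈ D) (hv : v ∈ D)
    (huv : u < v) (hC : ∀ x ∈ C, x < u) : C.card + 2 ≤ D.card := by
  have h1 : u ∉ C := fun hh => lt_irrefl _ (hC u hh)
  have h2 : v ∉ insert u C := by
    rw [Finset.mem_insert]
    rintro (hh | hh)
    · omega
    · have := hC v hh
      omega
  have h3 : insert v (insert u C) ⊆ D := by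
    intro x hx
    simp only [Finset.mem_insert] at hx
    rcases hx with rfl | rfl | hx
    · exact hv
    · exact hu
    · exact h hx
  have := Finset.card_le_card h3
  rw [Finset.card_insert_of_notMem h2, Finset.card_insert_of_notMem h1] at this
  omega

lemma one_new {C D : Finset ℤ} {u : ℤ} (h : C ⊆ D) (hu : u ∈ D)
    (hC : ∀ x ∈ C, x < u) : C.card + 1 ≤ D.card := by
  have h1 : u ∉ C := fun hh => lt_irrefl _ (hC u hh)
  have := Finset.card_le_card (Finset.insert_subset hu h)
  rwa [Finset.card_insert_of_notMem h1] at this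

lemma top2 {X : Finset ℤ} (h : 2 ≤ X.card) :
    ∃ m ∈ X, ∃ m' ∈ X, m' < m ∧ ∀ p ∈ X, ∀ q ∈ X, p ≠ q → p + q ≤ m + m' := by
  have hne : X.Nonempty := Finset.card_pos.1 (by omega)
  have hm := X.max'_mem hne
  have hle := X.le_max'
  generalize hmm : X.max' hne = m at hm
  have hle : ∀ x ∈ X, x ≤ m := fun x hx => hmm ▸ X.le_max' x hx
  have hne' : (X.erase m).Nonempty := Finset.card_pos.1 (by rw [Finset.card_erase_of_mem hm]; omega)
  obtain ⟨m', hm', hle'⟩ : ∃ m' ∈ X.erase m, ∀ x ∈ X.erase m, x ≤ m' :=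
    ⟨_, (X.erase m).max'_mem hne', fun x hx => Finset.le_max' _ x hx⟩
  rw [Finset.mem_erase] at hm'
  refine ⟨m, hm, m', hm'.2, lt_of_le_of_ne (hle _ hm'.2) hm'.1, fun p hp q hq hpq => ?_⟩
  by_cases hpm : p = m
  · have := hle' q (Finset.mem_erase.2 ⟨fun hh => hpq (hpm.trans hh.symm), hq⟩)
    omega
  · have := hle' p (Finset.mem_erase.2 ⟨hpm, hp⟩)
    have := hle q hq
    omega

/-- removing a common element above everything else loses at least two sums -/
lemma step {A B X Y : Finset ℤ} {a : ℤ} (hX : 2 ≤ X.card) (hXA : X ⊆ A) (hYX : Y ⊆ X) (hYB : Y ⊆ B)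
    (hlt : ∀ x ∈ X, x < a) (hs : ∀ x ∈ X, a + x ∈ restrictedSumset A B) :
    (restrictedSumset X Y).card + 2 ≤ (restrictedSumset A B).card := by
  obtain ⟨m, hm, m', hm', hlt', hmax⟩ := top2 hX
  refine two_new (rs_mono hXA hYB) (hs m' hm') (hs m hm) (by omega) ?_
  intro x hx
  obtain ⟨p, hp, q, hq, hpq, rfl⟩ := mem_rs.1 hx
  have := hmax p hp q (hYX hq) hpq
  have := hlt m hm
  omega

lemma lower (n : ℕ) : ∀ A B : Finset ℤ, A.card = n → B ⊆ A → B.Nonempty →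
    A.card + B.card ≤ (restrictedSumset A B).card + 3 ∧
    (A ≠ B → A.card + B.card ≤ (restrictedSumset A B).card + 2) := by
  induction n with
  | zero =>
    intro A B hA hBA hB
    have := Finset.card_le_card hBA
    have := Finset.card_pos.2 hB
    omega
  | succ n ih =>
    intro A B hA hBA hB
    have hBpos := Finset.card_pos.2 hB
    have hBAc := Finset.card_le_card hBA
    by_cases hB1 : B.card = 1
    · obtain ⟨b, rfl⟩ := Finset.card_eq_one.1 hB1
      have hb : b ∈ A := hBA (Finset.mem_singleton_self b)
      have h1 : (A.erase b).image (fun x => x + b) ⊆ restrictedSumset A {b} := by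
        intro x hx
        obtain ⟨y, hy, rfl⟩ := Finset.mem_image.1 hx
        rw [Finset.mem_erase] at hy
        exact mem_rs.2 ⟨y, hy.2, b, Finset.mem_singleton_self b, hy.1, rfl⟩
      have h2 := Finset.card_le_card h1
      rw [Finset.card_image_of_injective _ (add_left_injective b), Finset.card_erase_of_mem hb] at h2
      constructor
      · omega
      · intro _; omega
    · obtain ⟨a, ha, hle⟩ : ∃ a ∈ A, ∀ x ∈ A, x ≤ a :=
        ⟨_, A.max'_mem (hB.mono hBA), fun x hx => Finset.le_max' _ x hx⟩
      have hlt : ∀ x ∈ A.erase a, x < a := fun x hx =>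
        lt_of_le_of_ne (hle x (Finset.mem_of_mem_erase hx)) (Finset.ne_of_mem_erase hx)
      have hXc := Finset.card_erase_of_mem ha
      by_cases haB : a ∈ B
      · have hYc := Finset.card_erase_of_mem haB
        have hYX : B.erase a ⊆ A.erase a := Finset.erase_subset_erase a hBA
        have hs : ∀ x ∈ A.erase a, a + x ∈ restrictedSumset A B := fun x hx =>
          mem_rs.2 ⟨x, Finset.mem_of_mem_erase hx, a, haB, Finset.ne_of_mem_erase hx, add_comm _ _⟩
        have hYne : (B.erase a).Nonempty := Finset.card_pos.1 (by omega)
        have IH := ih (A.erase a) (B.erase a) (by omega) hYX hYne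
        by_cases hX2 : 2 ≤ (A.erase a).card
        · have := step hX2 (Finset.erase_subset a A) hYX (Finset.erase_subset a B) hlt hs
          refine ⟨by omega, fun hne => ?_⟩
          have := IH.2 (fun hh => hne (by
            rw [← Finset.insert_erase ha, hh, Finset.insert_erase haB]))
          omega
        · have heq : B = A := Finset.eq_of_subset_of_card_le hBA (by omega)
          obtain ⟨y, hy⟩ := hYne
          have := Finset.card_pos.2 ⟨_, hs y (hYX hy)⟩
          exact ⟨by omega, fun hne => absurd heq.symm hne⟩
      · have hBX : B ⊆ A.erase a := fun x hx =>
          Finset.mem_erase.2 ⟨fun hh => haB (hh ▸ hx), hBA hx⟩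
        have hs : ∀ x ∈ B, a + x ∈ restrictedSumset A B := fun x hx =>
          mem_rs.2 ⟨a, ha, x, hx, fun hh => haB (hh ▸ hx), rfl⟩
        have IH := ih (A.erase a) B (by omega) hBX hB
        have key : A.card + B.card ≤ (restrictedSumset A B).card + 2 := by
          by_cases hE : A.erase a = B
          · rw [hE] at IH hXc hlt
            have := step (X := B) (Y := B) (by omega) hBA (Finset.Subset.refl _)
              (Finset.Subset.refl _) hlt hs
            omega
          · have h1 := IH.2 hE
            obtain ⟨b, hb, hbl⟩ : ∃ b ∈ B, ∀ x ∈ B, x ≤ b :=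
              ⟨_, B.max'_mem hB, fun x hx => Finset.le_max' _ x hx⟩
            have := one_new (rs_mono (Finset.erase_subset a A) (Finset.Subset.refl B)) (hs b hb) (by
              intro x hx
              obtain ⟨p, hp, q, hq, hpq, rfl⟩ := mem_rs.1 hx
              have := hlt p hp
              have := hbl q hq
              omega)
            omega
        exact ⟨by omega, fun _ => key⟩

theorem stmt_6 (A B : Finset ℤ) (hA : 5 ≤ A.card) (hB : 2 ≤ B.card)
    (hBA : B ⊆ A)
    (hcrit : (restrictedSumset A B).card = A.card + B.card - 3)
    (hAne : A.Nonempty) (hBne : B.Nonempty) :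
    A.max' hAne = B.max' hBne ∧
      (restrictedSumset (A.erase (A.max' hAne)) (B.erase (B.max' hBne))).card =
        (A.erase (A.max' hAne)).card + (B.erase (B.max' hBne)).card - 3 := by
  have hAB : A = B := by
    by_contra hne
    have := (lower _ A B rfl hBA hBne).2 hne
    omega
  subst hAB
  refine ⟨rfl, ?_⟩
  have ha := A.max'_mem hAne
  have hle : ∀ x ∈ A, x ≤ A.max' hAne := fun x hx => A.le_max' x hx
  generalize A.max' hAne = a at ha hle
  have hXc := Finset.card_erase_of_mem ha
  have h1 := (lower _ (A.erase a) (A.erase a) rfl (Finset.Subset.refl _)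
    (Finset.card_pos.1 (by omega))).1
  have h2 := step (A := A) (B := A) (X := A.erase a) (Y := A.erase a) (a := a) (by omega)
    (Finset.erase_subset a A) (Finset.Subset.refl _) (Finset.erase_subset a A)
    (fun x hx => lt_of_le_of_ne (hle x (Finset.mem_of_mem_erase hx)) (Finset.ne_of_mem_erase hx))
    (fun x hx => mem_rs.2 ⟨x, Finset.mem_of_mem_erase hx, a, ha, Finset.ne_of_mem_erase hx,
      add_comm _ _⟩)
  omega
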